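/- For every integer k ≥ 2, the operators S_a = −P_q^{(a,a+1)} and E_a = −Q_q^{(a,a+1)} (a = 1, …, k−1) on V^{⊗k} satisfy all the defining relations of the Brauer algebra B_k(−2r): (i) S_a² = id, E_a² = −2r·E_a, S_a E_a = E_a S_a = E_a for all a; (ii) S_a S_b = S_b S_a, E_a E_b = E_b E_a, S_a E_b = E_b S_a whenever |a − b| > 1; (iii) S_a S_{a+1} S_a = S_{a+1} S_a S_{a+1}, E_a E_{a+1} E_a = E_a, E_{a+1} E_a E_{a+1} = E_{a+1}, S_a E_{a+1} E_a = S_{a+1} E_a, and E_{a+1} E_a S_{a+1} = E_{a+1} S_a for all a = 1, …, k−2. (Hence σ_a ↦ S_a, ε_a ↦ E_a defines a representation of the Brauer algebra B_k(−2r) on V^{⊗k}.) -/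

import Mathlib

open scoped BigOperators

noncomputable section

/-- The index set `I = {-r, …, -1, 1, …, r}` as a subtype of `ℤ`. -/
abbrev SIdx (r : ℕ) : Type := {i : ℤ // i ∈ (Finset.Icc (-(r : ℤ)) (r : ℤ)).erase 0}

instance (r : ℕ) : Neg (SIdx r) :=
  ⟨fun i => ⟨-i.1, by
    obtain ⟨h1, h2⟩ := Finset.mem_erase.mp i.2
    rw [Finset.mem_Icc] at h2
    exact Finset.mem_erase.mpr ⟨neg_ne_zero.mpr h1, Finset.mem_Icc.mpr (by omega)⟩⟩⟩

/-- The sign `ε_i`: `1` for `i > 0` and `-1` for `i < 0`, as an element of `K`. -/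
def sgn (K : Type*) [Field K] {r : ℕ} (i : SIdx r) : K := if 0 < i.1 then 1 else -1

/-- A symplectic parameter family `q = (q_{ij}, q_i)`: nonzero scalars with
`q_{ij} = q_{ji}⁻¹`, `q_{ii} = 1`, `q_{-i} = q_i⁻¹` and `q_{-i,j} = q_{ij}⁻¹ q_j²`. -/
structure SympParam (K : Type*) [Field K] (r : ℕ) where
  qm : SIdx r → SIdx r → K
  qv : SIdx r → K
  qm_ne : ∀ i j, qm i j ≠ 0
  qv_ne : ∀ i, qv i ≠ 0
  qm_symm : ∀ i j, qm i j = (qm j i)⁻¹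
  qm_diag : ∀ i, qm i i = 1
  qv_neg : ∀ i, qv (-i) = (qv i)⁻¹
  qm_neg : ∀ i j, qm (-i) j = (qm i j)⁻¹ * (qv j) ^ 2

variable {K : Type*} [Field K] [CharZero K] {r : ℕ}

/-- The operator `P_q` on `V ⊗ V`, where `V = SIdx r → K` and `V ⊗ V` is realized as
`(SIdx r × SIdx r) → K` with basis vector `e l ⊗ e m = Pi.single (l, m) 1`.  It sends
`e l ⊗ e m ↦ q_{lm} • (e m ⊗ e l)`. -/
def Pq (q : SympParam K r) : Module.End K (SIdx r × SIdx r → K) where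
  toFun f := fun p => q.qm p.2 p.1 * f (p.2, p.1)
  map_add' f g := by funext p; simp [mul_add]
  map_smul' c f := by funext p; simp [smul_eq_mul]; ring

/-- The operator `Q_q` on `V ⊗ V`: it sends
`e l ⊗ e m ↦ δ_{m,-l} ε_l q_l⁻¹ • ∑ i, ε_i q_i • (e i ⊗ e (-i))`. -/
def Qq (q : SympParam K r) : Module.End K (SIdx r × SIdx r → K) where
  toFun f := fun p =>
    if p.2 = -p.1 then
      sgn K p.1 * q.qv p.1 * ∑ l : SIdx r, sgn K l * (q.qv l)⁻¹ * f (l, -l)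
    else 0
  map_add' f g := by
    funext p
    by_cases h : p.2 = -p.1 <;> simp [h, mul_add, Finset.sum_add_distrib]
  map_smul' c f := by
    funext p
    by_cases h : p.2 = -p.1 <;>
      simp only [h, if_true, if_false, Pi.smul_apply, smul_eq_mul, RingHom.id_apply,
        Finset.mul_sum, mul_zero]
    · exact Finset.sum_congr rfl fun l _ => by ring

/-- The operator `T^{(a,b)}` on `V^{⊗k} = (Fin k → SIdx r) → K` (for `a ≠ b`): it acts as
`T` on the `a`-th and `b`-th tensor factors and as the identity on all other factors. -/
def liftAB {k : ℕ} (T : Module.End K (SIdx r × SIdx r → K)) (a b : Fin k) :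
    Module.End K ((Fin k → SIdx r) → K) where
  toFun f := fun v => ∑ l : SIdx r, ∑ m : SIdx r,
    T (Pi.single (l, m) 1) (v a, v b) * f (Function.update (Function.update v a l) b m)
  map_add' f g := by
    funext v
    simp [mul_add, Finset.sum_add_distrib]
  map_smul' c f := by
    funext v
    simp only [Pi.smul_apply, smul_eq_mul, RingHom.id_apply, Finset.mul_sum]
    congr 1; funext l; congr 1; funext m; ring

instance (r : ℕ) : InvolutiveNeg (SIdx r) where
  neg_neg i := Subtype.ext (neg_neg i.1)

section SignAndParameters

variable {F : Type*} [Field F]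

theorem sgn_neg (i : SIdx r) : sgn F (-i) = -sgn F i := by
  have h : (-i).1 = -i.1 := rfl
  have h0 : i.1 ≠ 0 := (Finset.mem_erase.mp i.2).1
  unfold sgn
  rw [h]
  split_ifs <;> first | omega | simp

theorem sgn_mul_self (i : SIdx r) : sgn F i * sgn F i = 1 := by
  unfold sgn
  split_ifs <;> simp

theorem card_SIdx (r : ℕ) : Fintype.card (SIdx r) = 2 * r := by
  rw [Fintype.card_coe, Finset.card_erase_of_mem (by simp), Int.card_Icc]
  omega

namespace SympParam

variable (q : SympParam F r)

/-- The coefficient `ε_i q_i` of `e_i ⊗ e_{-i}` in the image of `Q_q`. -/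
def vec (i : SIdx r) : F := sgn F i * q.qv i

/-- The coefficient `ε_i q_i⁻¹` by which `Q_q` pairs `e_i ⊗ e_{-i}`. -/
def covec (i : SIdx r) : F := sgn F i * (q.qv i)⁻¹

theorem vec_neg (i : SIdx r) : q.vec (-i) = -q.covec i := by
  simp [vec, covec, sgn_neg, q.qv_neg]

theorem covec_neg (i : SIdx r) : q.covec (-i) = -q.vec i := by
  simp [vec, covec, sgn_neg, q.qv_neg]

theorem covec_mul_vec (i : SIdx r) : q.covec i * q.vec i = 1 := by
  have h := sgn_mul_self (F := F) i
  have h' := inv_mul_cancel₀ (q.qv_ne i)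
  unfold vec covec
  linear_combination (q.qv i)⁻¹ * q.qv i * h + h'

theorem vec_mul_vec (i : SIdx r) : q.vec i * q.vec i = q.qv i ^ 2 := by
  unfold vec
  linear_combination q.qv i ^ 2 * sgn_mul_self (F := F) i

theorem qm_mul_qm (i j : SIdx r) : q.qm i j * q.qm j i = 1 := by
  rw [q.qm_symm i j, inv_mul_cancel₀ (q.qm_ne j i)]

/-- Replacing `i` by `-i` reverses the crossing with `j`, up to the factor `q_j²`. -/
theorem qm_neg_left (i j : SIdx r) : q.qm (-i) j = q.qm j i * (q.vec j * q.vec j) := by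
  rw [q.qm_neg, vec_mul_vec, q.qm_symm j i]

theorem qm_neg_right (i j : SIdx r) :
    q.qm j (-i) = q.qm i j * (q.covec j * q.covec j) := by
  have h := q.qm_mul_qm (-i) j
  rw [q.qm_neg_left] at h
  have h1 := q.qm_mul_qm i j
  have h2 := q.covec_mul_vec j
  have h3 : q.covec j * q.covec j * (q.vec j * q.vec j) = 1 := by
    linear_combination (q.covec j * q.vec j + 1) * h2
  linear_combination q.qm i j * (q.covec j * q.covec j) * h
    - q.qm j (-i) * h1 * (q.covec j * q.covec j * (q.vec j * q.vec j)) - q.qm j (-i) * h3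

theorem qm_self_neg (i : SIdx r) : q.qm i (-i) = q.covec i * q.covec i := by
  rw [q.qm_neg_right, q.qm_diag, one_mul]

theorem qm_neg_self (i : SIdx r) : q.qm (-i) i = q.vec i * q.vec i := by
  rw [q.qm_neg_left, q.qm_diag, one_mul]

end SympParam

end SignAndParameters

section Lift

open Function

variable {F : Type*} [Field F] {k : ℕ} (q : SympParam F r) {a b c d : Fin k}

theorem liftAB_Pq_apply (a b : Fin k) (f : (Fin k → SIdx r) → F) (v : Fin k → SIdx r) :
    liftAB (Pq q) a b f v = q.qm (v b) (v a) * f (update (update v a (v b)) b (v a)) := by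
  change (∑ l, ∑ m, q.qm (v b) (v a) * Pi.single (M := fun _ => F) (l, m) (1 : F) (v b, v a) *
    f (update (update v a l) b m)) = _
  rw [Finset.sum_eq_single (v b), Finset.sum_eq_single (v a)]
  · simp
  · intro m _ hm
    rw [Pi.single_eq_of_ne (by simp [hm.symm])]
    simp
  · simp
  · intro l _ hl
    refine Finset.sum_eq_zero fun m _ => ?_
    rw [Pi.single_eq_of_ne (by simp [hl.symm])]
    simp
  · simp

theorem liftAB_apply (T : Module.End F (SIdx r × SIdx r → F)) (a b : Fin k)
    (f : (Fin k → SIdx r) → F) (v : Fin k → SIdx r) :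
    liftAB T a b f v =
      ∑ p, T (Pi.single p 1) (v a, v b) * f (update (update v a p.1) b p.2) :=
  (Fintype.sum_prod_type fun p : SIdx r × SIdx r =>
    T (Pi.single p 1) (v a, v b) * f (update (update v a p.1) b p.2)).symm

theorem liftAB_comm_of_disjoint (T U : Module.End F (SIdx r × SIdx r → F))
    (hac : a ≠ c) (had : a ≠ d) (hbc : b ≠ c) (hbd : b ≠ d) :
    liftAB T a b * liftAB U c d = liftAB U c d * liftAB T a b := by
  refine LinearMap.ext fun f => funext fun v => ?_
  simp only [Module.End.mul_apply, liftAB_apply, Finset.mul_sum,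
    update_of_ne hac, update_of_ne had, update_of_ne hbc, update_of_ne hbd,
    update_of_ne hac.symm, update_of_ne had.symm, update_of_ne hbc.symm, update_of_ne hbd.symm]
  rw [Finset.sum_comm]
  refine Finset.sum_congr rfl fun x _ => Finset.sum_congr rfl fun y _ => ?_
  rw [update_comm hbc, update_comm hac, update_comm hbd, update_comm had]
  ring

theorem liftAB_Pq_mul_self (hab : a ≠ b) :
    liftAB (Pq q) a b * liftAB (Pq q) a b = 1 := by
  refine LinearMap.ext fun f => funext fun v => ?_
  simp [liftAB_Pq_apply, update_of_ne hab, update_comm hab.symm, ← mul_assoc, q.qm_mul_qm]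

theorem liftAB_Pq_braid (hab : a ≠ b) (hac : a ≠ c) (hbc : b ≠ c) :
    liftAB (Pq q) a b * liftAB (Pq q) b c * liftAB (Pq q) a b =
      liftAB (Pq q) b c * liftAB (Pq q) a b * liftAB (Pq q) b c := by
  refine LinearMap.ext fun f => funext fun v => ?_
  simp only [Module.End.mul_apply, liftAB_Pq_apply, update_self, update_of_ne hab,
    update_of_ne hac, update_of_ne hbc, update_of_ne hac.symm,
    update_of_ne hbc.symm, update_comm hab.symm, update_comm hac.symm, update_comm hbc.symm,
    update_idem]
  ring

end Lift

section Contraction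

open Function

variable {k : ℕ} (q : SympParam K r) {a b c : Fin k}

theorem liftAB_Qq_apply (a b : Fin k) (f : (Fin k → SIdx r) → K) (v : Fin k → SIdx r) :
    liftAB (Qq q) a b f v = if v b = -v a then
      q.vec (v a) * ∑ l, q.covec l * f (update (update v a l) b (-l)) else 0 := by
  have key (l m : SIdx r) : (∑ n, q.covec n * Pi.single (M := fun _ => K) (l, m) (1 : K) (n, -n)) =
      if m = -l then q.covec l else 0 := by
    rw [Finset.sum_eq_single l]
    · simp [Pi.single_apply, eq_comm]
    · intro n _ hn
      simp [hn]
    · simp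
  change (∑ l, ∑ m, (if v b = -v a then q.vec (v a) *
    ∑ n, q.covec n * Pi.single (M := fun _ => K) (l, m) (1 : K) (n, -n) else 0) *
    f (update (update v a l) b m)) = _
  simp only [key]
  split_ifs
  · simp [Finset.mul_sum, mul_assoc]
  · simp

theorem liftAB_Qq_mul_self (hab : a ≠ b) :
    liftAB (Qq q) a b * liftAB (Qq q) a b = (2 * (r : K)) • liftAB (Qq q) a b := by
  refine LinearMap.ext fun f => funext fun v => ?_
  simp only [Module.End.mul_apply, LinearMap.smul_apply, Pi.smul_apply, smul_eq_mul,
    liftAB_Qq_apply, update_self, update_of_ne hab, update_comm hab.symm, update_idem,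
    if_true, ← mul_assoc, q.covec_mul_vec, one_mul]
  rw [Finset.sum_const, Finset.card_univ, card_SIdx, nsmul_eq_mul]
  push_cast
  split_ifs <;> ring

theorem liftAB_Pq_mul_Qq (hab : a ≠ b) :
    liftAB (Pq q) a b * liftAB (Qq q) a b = -liftAB (Qq q) a b := by
  refine LinearMap.ext fun f => funext fun v => ?_
  simp only [Module.End.mul_apply, LinearMap.neg_apply, Pi.neg_apply, liftAB_Pq_apply,
    liftAB_Qq_apply, update_self, update_of_ne hab, update_comm hab.symm, update_idem]
  by_cases h : v b = -v a
  · simp only [h, neg_neg, if_true, q.qm_neg_self, q.vec_neg]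
    linear_combination (-q.vec (v a) * ∑ l, q.covec l * f (update (update v a l) b (-l))) *
      q.covec_mul_vec (v a)
  · have h' : v a ≠ -v b := fun e => h (by rw [e, neg_neg])
    simp [h, h']

theorem liftAB_Qq_mul_Pq (hab : a ≠ b) :
    liftAB (Qq q) a b * liftAB (Pq q) a b = -liftAB (Qq q) a b := by
  refine LinearMap.ext fun f => funext fun v => ?_
  simp only [Module.End.mul_apply, LinearMap.neg_apply, Pi.neg_apply, liftAB_Pq_apply,
    liftAB_Qq_apply, update_self, update_of_ne hab, update_comm hab.symm, update_idem]
  split_ifs with h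
  · rw [← mul_neg, ← Finset.sum_neg_distrib, ← Equiv.sum_comp (Equiv.neg (SIdx r))]
    congr 1
    refine Finset.sum_congr rfl fun l _ => ?_
    simp only [Equiv.neg_apply, neg_neg, q.qm_self_neg, q.covec_neg]
    linear_combination (-q.covec l * f (update (update v a l) b (-l))) * q.covec_mul_vec l
  · simp

/-- Composing the contractions on `(a,b)` and `(b,c)` moves the factor at `c` to `a`. -/
theorem liftAB_Qq_mul_Qq_apply (hac : a ≠ c) (hbc : b ≠ c)
    (f : (Fin k → SIdx r) → K) (v : Fin k → SIdx r) :
    liftAB (Qq q) a b (liftAB (Qq q) b c f) v = if v b = -v a then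
      -(q.vec (v a) * q.covec (v c) ^ 2) *
        ∑ m, q.covec m * f (update (update (update v a (v c)) b m) c (-m)) else 0 := by
  simp only [liftAB_Qq_apply, update_self, update_of_ne hac.symm, update_of_ne hbc.symm,
    update_idem, neg_neg, mul_ite, mul_zero,
    Finset.sum_ite_eq, Finset.mem_univ, if_true, q.vec_neg]
  split_ifs
  · ring
  · rfl

/-- Composing the contractions on `(b,c)` and `(a,b)` moves the factor at `a` to `c`. -/
theorem liftAB_Qq_mul_Qq_apply' (hab : a ≠ b) (hac : a ≠ c) (hbc : b ≠ c)
    (f : (Fin k → SIdx r) → K) (v : Fin k → SIdx r) :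
    liftAB (Qq q) b c (liftAB (Qq q) a b f) v = if v c = -v b then
      -(q.vec (v b) * q.vec (v a) ^ 2) *
        ∑ m, q.covec m * f (update (update (update v a m) b (-m)) c (v a)) else 0 := by
  simp only [liftAB_Qq_apply, update_self, update_of_ne hab,
    update_of_ne hac, update_of_ne hbc,
    update_comm hab.symm, update_comm hac.symm, update_comm hbc.symm,
    update_idem, neg_neg, mul_ite, mul_zero,
    Finset.sum_ite_eq', Finset.mem_univ, if_true, q.covec_neg]
  split_ifs
  · ring
  · rfl

theorem liftAB_Qq_mul_Qq_mul_Qq (hab : a ≠ b) (hac : a ≠ c) (hbc : b ≠ c) :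
    liftAB (Qq q) a b * liftAB (Qq q) b c * liftAB (Qq q) a b = liftAB (Qq q) a b := by
  refine LinearMap.ext fun f => funext fun v => ?_
  rw [Module.End.mul_apply, Module.End.mul_apply, liftAB_Qq_mul_Qq_apply q hac hbc]
  simp only [liftAB_Qq_apply, update_self, update_of_ne hab,
    update_of_ne hac, update_of_ne hbc,
    update_comm hab.symm, update_comm hac.symm, update_comm hbc.symm,
    update_idem, mul_ite, mul_zero,
    Finset.sum_ite_eq', Finset.mem_univ, if_true, q.covec_neg, neg_neg]
  split_ifs
  · have hv (x : SIdx r) : update (update (update v a x) b (-x)) c (v c) =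
        update (update v a x) b (-x) := by
      rw [update_eq_self_iff, update_of_ne hbc.symm, update_of_ne hac.symm]
    simp only [hv]
    linear_combination (q.vec (v a) * ∑ x, q.covec x * f (update (update v a x) b (-x))) *
      (q.covec (v c) * q.vec (v c) + 1) * q.covec_mul_vec (v c)
  · rfl

theorem liftAB_Qq_mul_Qq_mul_Qq' (hab : a ≠ b) (hac : a ≠ c) (hbc : b ≠ c) :
    liftAB (Qq q) b c * liftAB (Qq q) a b * liftAB (Qq q) b c = liftAB (Qq q) b c := by
  refine LinearMap.ext fun f => funext fun v => ?_
  rw [Module.End.mul_apply, Module.End.mul_apply, liftAB_Qq_mul_Qq_apply' q hab hac hbc]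
  simp only [liftAB_Qq_apply, update_self, update_of_ne hbc, update_comm hbc.symm, update_idem,
    mul_ite, mul_zero,
    Finset.sum_ite_eq, Finset.mem_univ, if_true, q.vec_neg, neg_neg]
  split_ifs
  · simp only [update_eq_self]
    linear_combination (q.vec (v b) * ∑ x, q.covec x * f (update (update v b x) c (-x))) *
      (q.covec (v a) * q.vec (v a) + 1) * q.covec_mul_vec (v a)
  · rfl

theorem liftAB_Pq_mul_Qq_mul_Qq (hab : a ≠ b) (hac : a ≠ c) (hbc : b ≠ c) :
    liftAB (Pq q) a b * liftAB (Qq q) b c * liftAB (Qq q) a b =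
      -(liftAB (Pq q) b c * liftAB (Qq q) a b) := by
  refine LinearMap.ext fun f => funext fun v => ?_
  simp only [Module.End.mul_apply, LinearMap.neg_apply, Pi.neg_apply, liftAB_Pq_apply,
    liftAB_Qq_mul_Qq_apply' q hab hac hbc]
  simp only [liftAB_Qq_apply, update_self, update_of_ne hab,
    update_of_ne hac, update_of_ne hbc, update_of_ne hac.symm,
    update_of_ne hbc.symm, update_comm hab.symm, update_comm hac.symm, update_comm hbc.symm,
    update_idem]
  split_ifs with h
  · rw [h, q.qm_neg_left]
    ring
  · simp

theorem liftAB_Qq_mul_Qq_mul_Pq (hab : a ≠ b) (hac : a ≠ c) (hbc : b ≠ c) :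
    liftAB (Qq q) b c * liftAB (Qq q) a b * liftAB (Pq q) b c =
      -(liftAB (Qq q) b c * liftAB (Pq q) a b) := by
  refine LinearMap.ext fun f => funext fun v => ?_
  simp only [Module.End.mul_apply, LinearMap.neg_apply, Pi.neg_apply,
    liftAB_Qq_mul_Qq_apply' q hab hac hbc]
  simp only [liftAB_Qq_apply, liftAB_Pq_apply, update_self, update_of_ne hab,
    update_of_ne hac, update_of_ne hbc,
    update_comm hab.symm, update_comm hac.symm, update_comm hbc.symm,
    update_idem]
  split_ifs with h
  · simp only [Finset.mul_sum, ← Finset.sum_neg_distrib, q.qm_neg_right]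
    refine Finset.sum_congr rfl fun m _ => ?_
    linear_combination (-q.vec (v b) * q.covec m * q.qm m (v a) *
      f (update (update (update v a m) b (v a)) c (-m))) *
      (q.covec (v a) * q.vec (v a) + 1) * q.covec_mul_vec (v a)
  · simp

end Contraction

/-- for `k ≥ 2`, the operators `S_a = −P_q^{(a,a+1)}` and `E_a = −Q_q^{(a,a+1)}`
on `V^{⊗k}` satisfy all the defining relations of the Brauer algebra `B_k(−2r)`
(positions are numbered `0, …, k−1`). -/
theorem brauer_relations (hr : 1 ≤ r) (q : SympParam K r) (k : ℕ) (hk : 2 ≤ k)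
    (S E : ℕ → Module.End K ((Fin k → SIdx r) → K))
    (hS : ∀ (a : ℕ) (h : a + 1 < k), S a = -liftAB (Pq q) ⟨a, by omega⟩ ⟨a + 1, h⟩)
    (hE : ∀ (a : ℕ) (h : a + 1 < k), E a = -liftAB (Qq q) ⟨a, by omega⟩ ⟨a + 1, h⟩) :
    (∀ a, a + 1 < k →
        S a * S a = 1 ∧ E a * E a = (-(2 * (r : K))) • E a ∧
        S a * E a = E a ∧ E a * S a = E a) ∧
    (∀ a b, a + 1 < k → b + 1 < k → (a + 1 < b ∨ b + 1 < a) →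
        S a * S b = S b * S a ∧ E a * E b = E b * E a ∧ S a * E b = E b * S a) ∧
    (∀ a, a + 2 < k →
        S a * S (a + 1) * S a = S (a + 1) * S a * S (a + 1) ∧
        E a * E (a + 1) * E a = E a ∧
        E (a + 1) * E a * E (a + 1) = E (a + 1) ∧
        S a * E (a + 1) * E a = S (a + 1) * E a ∧
        E (a + 1) * E a * S (a + 1) = E (a + 1) * S a) := by
  have neg_mul_end (A B : Module.End K ((Fin k → SIdx r) → K)) : -A * B = -(A * B) :=
    neg_mul A B
  have mul_neg_end (A B : Module.End K ((Fin k → SIdx r) → K)) : A * -B = -(A * B) :=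
    mul_neg A B
  refine ⟨fun a h => ?_, fun a b ha hb hab => ?_, fun a h => ?_⟩
  · have hne : (⟨a, by omega⟩ : Fin k) ≠ ⟨a + 1, h⟩ := by simp
    rw [hS a h, hE a h]
    simp only [neg_mul_end, mul_neg_end, liftAB_Pq_mul_self q hne, liftAB_Qq_mul_self q hne,
      liftAB_Pq_mul_Qq q hne, liftAB_Qq_mul_Pq q hne, neg_smul, smul_neg, neg_neg, and_self]
  · rw [hS a ha, hE a ha, hS b hb, hE b hb]
    simp only [neg_mul_end, mul_neg_end, neg_neg]
    refine ⟨?_, ?_, ?_⟩ <;> apply liftAB_comm_of_disjoint <;> rw [Ne, Fin.mk.injEq] <;> omega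
  · have hab : (⟨a, by omega⟩ : Fin k) ≠ ⟨a + 1, by omega⟩ := by simp
    have hac : (⟨a, by omega⟩ : Fin k) ≠ ⟨a + 1 + 1, h⟩ := by rw [Ne, Fin.mk.injEq]; omega
    have hbc : (⟨a + 1, by omega⟩ : Fin k) ≠ ⟨a + 1 + 1, h⟩ := by simp
    rw [hS a (by omega), hE a (by omega), hS (a + 1) h, hE (a + 1) h]
    simp only [neg_mul_end, mul_neg_end, liftAB_Pq_braid q hab hac hbc,
      liftAB_Qq_mul_Qq_mul_Qq q hab hac hbc, liftAB_Qq_mul_Qq_mul_Qq' q hab hac hbc,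
      liftAB_Pq_mul_Qq_mul_Qq q hab hac hbc, liftAB_Qq_mul_Qq_mul_Pq q hab hac hbc,
      neg_neg, and_self]
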